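/- Let μ, ε, k > 0, let u : ℝ² × ℝ → ℂ be a smooth solution of NLSW (−i ∂_t u + μ k ∂_t² u − Δ u + (1/ε²)(|u|² − 1) u = 0) that is ℤ²-periodic in space, and let φ : ℝ² → ℝ be smooth and ℤ²-periodic. Then for every t ∈ ℝ: −μk ∫_{[0,1]²} ∂_t ⟨𝕁∇u, (∂_t u) ∇φ⟩ dx − ∫_{[0,1]²} (∂_t J(u)) φ dx = ∫_{[0,1]²} ⟨Hess(φ)∇u, 𝕁∇u⟩ dx, where all derivatives are evaluated at (x, t). -/

import Mathlib

open MeasureTheory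

/-- Partial derivative in the first space variable x of a function on `ℝ × ℝ × ℝ`
(coordinates `(x, y, t)`). -/
noncomputable def pdx {E : Type*} [NormedAddCommGroup E] [NormedSpace ℝ E]
    (f : ℝ × ℝ × ℝ → E) (p : ℝ × ℝ × ℝ) : E := fderiv ℝ f p (1, 0, 0)

/-- Partial derivative in the second space variable y. -/
noncomputable def pdy {E : Type*} [NormedAddCommGroup E] [NormedSpace ℝ E]
    (f : ℝ × ℝ × ℝ → E) (p : ℝ × ℝ × ℝ) : E := fderiv ℝ f p (0, 1, 0)

/-- Partial derivative in the time variable t. -/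
noncomputable def pdt {E : Type*} [NormedAddCommGroup E] [NormedSpace ℝ E]
    (f : ℝ × ℝ × ℝ → E) (p : ℝ × ℝ × ℝ) : E := fderiv ℝ f p (0, 0, 1)

/-- Partial derivative in the first (x) variable of a function on `ℝ × ℝ`. -/
noncomputable def pdx2 {E : Type*} [NormedAddCommGroup E] [NormedSpace ℝ E]
    (f : ℝ × ℝ → E) (p : ℝ × ℝ) : E := fderiv ℝ f p (1, 0)

/-- Partial derivative in the second (y) variable of a function on `ℝ × ℝ`. -/
noncomputable def pdy2 {E : Type*} [NormedAddCommGroup E] [NormedSpace ℝ E]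
    (f : ℝ × ℝ → E) (p : ℝ × ℝ) : E := fderiv ℝ f p (0, 1)

open scoped ContDiff

section DirectionalDerivative

variable {V W E : Type*} [NormedAddCommGroup V] [NormedSpace ℝ V]
  [NormedAddCommGroup W] [NormedSpace ℝ W] [NormedAddCommGroup E] [NormedSpace ℝ E]

/-- The derivative of `f` in the fixed direction `v`, as a function of the base point. -/
noncomputable def dirDeriv (v : V) (f : V → E) (p : V) : E := fderiv ℝ f p v

@[fun_prop]
lemma ContDiff.dirDeriv {f : V → E} (hf : ContDiff ℝ ∞ f) (v : V) :
    ContDiff ℝ ∞ (dirDeriv v f) :=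
  (hf.fderiv_right (m := ∞) le_rfl).clm_apply contDiff_const

@[fun_prop]
lemma ContDiff.complex_re {f : V → ℂ} (hf : ContDiff ℝ ∞ f) :
    ContDiff ℝ ∞ fun q => (f q).re :=
  Complex.reCLM.contDiff.comp hf

@[fun_prop]
lemma ContDiff.complex_im {f : V → ℂ} (hf : ContDiff ℝ ∞ f) :
    ContDiff ℝ ∞ fun q => (f q).im :=
  Complex.imCLM.contDiff.comp hf

lemma ContDiff.differentiableAt_of_smooth {f : V → E} (hf : ContDiff ℝ ∞ f) (p : V) :
    DifferentiableAt ℝ f p :=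
  hf.differentiable (by simp) p

lemma dirDeriv_zero (f : V → E) (p : V) : dirDeriv 0 f p = 0 := by
  simp [dirDeriv]

lemma dirDeriv_const (v : V) (c : E) (p : V) : dirDeriv v (fun _ => c) p = 0 := by
  simp [dirDeriv]

lemma dirDeriv_add {f g : V → E} (hf : ContDiff ℝ ∞ f) (hg : ContDiff ℝ ∞ g) (v p : V) :
    dirDeriv v (fun q => f q + g q) p = dirDeriv v f p + dirDeriv v g p := by
  simp [dirDeriv, fderiv_fun_add (hf.differentiableAt_of_smooth p)
    (hg.differentiableAt_of_smooth p)]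

lemma dirDeriv_sub {f g : V → E} (hf : ContDiff ℝ ∞ f) (hg : ContDiff ℝ ∞ g) (v p : V) :
    dirDeriv v (fun q => f q - g q) p = dirDeriv v f p - dirDeriv v g p := by
  simp [dirDeriv, fderiv_fun_sub (hf.differentiableAt_of_smooth p)
    (hg.differentiableAt_of_smooth p)]

lemma dirDeriv_neg (f : V → E) (v p : V) :
    dirDeriv v (fun q => -f q) p = -dirDeriv v f p := by
  simp [dirDeriv, fderiv_fun_neg]

lemma dirDeriv_mul {f g : V → ℝ} (hf : ContDiff ℝ ∞ f) (hg : ContDiff ℝ ∞ g) (v p : V) :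
    dirDeriv v (fun q => f q * g q) p = f p * dirDeriv v g p + g p * dirDeriv v f p := by
  simp [dirDeriv, fderiv_fun_mul (hf.differentiableAt_of_smooth p)
    (hg.differentiableAt_of_smooth p)]

lemma dirDeriv_sq {f : V → ℝ} (hf : ContDiff ℝ ∞ f) (v p : V) :
    dirDeriv v (fun q => f q ^ 2) p = 2 * f p * dirDeriv v f p := by
  simp only [pow_two, dirDeriv_mul hf hf]
  ring

lemma dirDeriv_clm_comp {F : Type*} [NormedAddCommGroup F] [NormedSpace ℝ F] {f : V → E}
    (L : E →L[ℝ] F) (hf : ContDiff ℝ ∞ f) (v p : V) :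
    dirDeriv v (fun q => L (f q)) p = L (dirDeriv v f p) := by
  simp [dirDeriv, (L.hasFDerivAt.comp p (hf.differentiableAt_of_smooth p).hasFDerivAt).fderiv,
    show (fun q => L (f q)) = L ∘ f from rfl]

lemma dirDeriv_re {f : V → ℂ} (hf : ContDiff ℝ ∞ f) (v p : V) :
    dirDeriv v (fun q => (f q).re) p = (dirDeriv v f p).re :=
  dirDeriv_clm_comp Complex.reCLM hf v p

lemma dirDeriv_im {f : V → ℂ} (hf : ContDiff ℝ ∞ f) (v p : V) :
    dirDeriv v (fun q => (f q).im) p = (dirDeriv v f p).im :=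
  dirDeriv_clm_comp Complex.imCLM hf v p

lemma dirDeriv_comp_clm {f : W → E} (hf : ContDiff ℝ ∞ f) (L : V →L[ℝ] W) (v p : V) :
    dirDeriv v (fun q => f (L q)) p = dirDeriv (L v) f (L p) := by
  have h : (fun q => f (L q)) = f ∘ L := rfl
  simp [dirDeriv, h,
    ((hf.differentiableAt_of_smooth (L p)).hasFDerivAt.comp p L.hasFDerivAt).fderiv]

lemma dirDeriv_comm {f : V → E} (hf : ContDiff ℝ ∞ f) (v w p : V) :
    dirDeriv v (dirDeriv w f) p = dirDeriv w (dirDeriv v f) p := by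
  have hd : DifferentiableAt ℝ (fderiv ℝ f) p :=
    (hf.fderiv_right (m := ∞) le_rfl).differentiableAt_of_smooth p
  have key (a b : V) : dirDeriv a (dirDeriv b f) p = fderiv ℝ (fderiv ℝ f) p a b :=
    congrArg (fun T => T a) (hd.hasFDerivAt.clm_apply (hasFDerivAt_const b p)).fderiv |>.trans
      (by simp)
  rw [key, key]
  exact hf.contDiffAt.isSymmSndFDerivAt (by simpa using ENat.LEInfty.out) v w

lemma dirDeriv_periodic {f : V → E} {c : V} (hf : ∀ p, f (p + c) = f p) (v p : V) :
    dirDeriv v f (p + c) = dirDeriv v f p := by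
  rw [dirDeriv, dirDeriv, ← fderiv_comp_add_right]
  simp only [hf]

end DirectionalDerivative

lemma pdx_eq_dirDeriv {E : Type*} [NormedAddCommGroup E] [NormedSpace ℝ E]
    (f : ℝ × ℝ × ℝ → E) : pdx f = dirDeriv (1, 0, 0) f := rfl

lemma pdy_eq_dirDeriv {E : Type*} [NormedAddCommGroup E] [NormedSpace ℝ E]
    (f : ℝ × ℝ × ℝ → E) : pdy f = dirDeriv (0, 1, 0) f := rfl

lemma pdt_eq_dirDeriv {E : Type*} [NormedAddCommGroup E] [NormedSpace ℝ E]
    (f : ℝ × ℝ × ℝ → E) : pdt f = dirDeriv (0, 0, 1) f := rfl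

lemma pdx2_eq_dirDeriv {E : Type*} [NormedAddCommGroup E] [NormedSpace ℝ E]
    (f : ℝ × ℝ → E) : pdx2 f = dirDeriv (1, 0) f := rfl

lemma pdy2_eq_dirDeriv {E : Type*} [NormedAddCommGroup E] [NormedSpace ℝ E]
    (f : ℝ × ℝ → E) : pdy2 f = dirDeriv (0, 1) f := rfl

lemma dirDeriv_comp_space {f : ℝ × ℝ → ℝ} (hf : ContDiff ℝ ∞ f) (v p : ℝ × ℝ × ℝ) :
    dirDeriv v (fun q => f (q.1, q.2.1)) p = dirDeriv (v.1, v.2.1) f (p.1, p.2.1) :=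
  dirDeriv_comp_clm hf ((ContinuousLinearMap.fst ℝ ℝ (ℝ × ℝ)).prod
    ((ContinuousLinearMap.fst ℝ ℝ ℝ).comp (ContinuousLinearMap.snd ℝ ℝ (ℝ × ℝ)))) v p

lemma Continuous.integrableOn_unitSquare {f : ℝ × ℝ → ℝ} (hf : Continuous f) :
    IntegrableOn f (Set.Icc (0 : ℝ) 1 ×ˢ Set.Icc (0 : ℝ) 1) :=
  hf.continuousOn.integrableOn_compact (isCompact_Icc.prod isCompact_Icc)

lemma Continuous.integral_unitSquare {f : ℝ × ℝ → ℝ} (hf : Continuous f) :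
    ∫ x in Set.Icc (0 : ℝ) 1, ∫ y in Set.Icc (0 : ℝ) 1, f (x, y) =
      ∫ p in Set.Icc (0 : ℝ) 1 ×ˢ Set.Icc (0 : ℝ) 1, f p :=
  (setIntegral_prod f hf.integrableOn_unitSquare).symm

/-- The divergence of a smooth periodic vector field has zero integral over the unit square. -/
lemma integral_divergence_periodic {F G : ℝ × ℝ → ℝ} (hF : ContDiff ℝ ∞ F)
    (hG : ContDiff ℝ ∞ G) (hFper : ∀ p, F (p + (1, 0)) = F p)
    (hGper : ∀ p, G (p + (0, 1)) = G p) :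
    ∫ p in Set.Icc (0 : ℝ) 1 ×ˢ Set.Icc (0 : ℝ) 1,
      (dirDeriv (1, 0) F p + dirDeriv (0, 1) G p) = 0 := by
  have hFc := (hF.dirDeriv (1, 0)).continuous
  have hGc := (hG.dirDeriv (0, 1)).continuous
  have h := integral_divergence_prod_Icc_of_hasFDerivAt_of_le F G (fderiv ℝ F) (fderiv ℝ G)
    (0, 0) (1, 1) (by simp [Prod.le_def]) hF.continuous.continuousOn hG.continuous.continuousOn
    (fun p _ => (hF.differentiableAt_of_smooth p).hasFDerivAt)
    (fun p _ => (hG.differentiableAt_of_smooth p).hasFDerivAt)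
    ((hFc.add hGc).continuousOn.integrableOn_compact isCompact_Icc)
  have h₁ (y : ℝ) : F (1, y) = F (0, y) := by simpa using hFper (0, y)
  have h₂ (x : ℝ) : G (x, 1) = G (x, 0) := by simpa using hGper (x, 0)
  rw [Set.Icc_prod_Icc]
  simpa [h₁, h₂, dirDeriv] using h

section Flux

variable (μ ε k : ℝ) (u : ℝ × ℝ × ℝ → ℂ) (φ : ℝ × ℝ → ℝ)

/-- The combination `μk|∂ₜu|²/2 - |∇u|²/2 - (|u|² - 1)²/(4ε²)`. -/
noncomputable def lagrangianDensity (q : ℝ × ℝ × ℝ) : ℝ :=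
  μ * k * ((dirDeriv (0, 0, 1) u q).re ^ 2 + (dirDeriv (0, 0, 1) u q).im ^ 2) * (1 / 2)
    - ((dirDeriv (1, 0, 0) u q).re ^ 2 + (dirDeriv (1, 0, 0) u q).im ^ 2
      + (dirDeriv (0, 1, 0) u q).re ^ 2 + (dirDeriv (0, 1, 0) u q).im ^ 2) * (1 / 2)
    - 1 / ε ^ 2 * ((u q).re ^ 2 + (u q).im ^ 2 - 1) ^ 2 * (1 / 4)

/-- The first component of the flux whose divergence is the defect in the vorticity identity. -/
noncomputable def vorticityFluxX (q : ℝ × ℝ × ℝ) : ℝ :=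
  -((dirDeriv (0, 0, 1) u q).re * (dirDeriv (0, 1, 0) u q).im
      - (dirDeriv (0, 0, 1) u q).im * (dirDeriv (0, 1, 0) u q).re) * φ (q.1, q.2.1)
    + lagrangianDensity μ ε k u q * dirDeriv (0, 1) φ (q.1, q.2.1)
    - ((dirDeriv (1, 0, 0) u q).re * ((dirDeriv (0, 1, 0) u q).re * dirDeriv (1, 0) φ (q.1, q.2.1)
          - (dirDeriv (1, 0, 0) u q).re * dirDeriv (0, 1) φ (q.1, q.2.1))
      + (dirDeriv (1, 0, 0) u q).im * ((dirDeriv (0, 1, 0) u q).im * dirDeriv (1, 0) φ (q.1, q.2.1)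
          - (dirDeriv (1, 0, 0) u q).im * dirDeriv (0, 1) φ (q.1, q.2.1)))

/-- The second component of the flux whose divergence is the defect in the vorticity identity. -/
noncomputable def vorticityFluxY (q : ℝ × ℝ × ℝ) : ℝ :=
  -((dirDeriv (1, 0, 0) u q).re * (dirDeriv (0, 0, 1) u q).im
      - (dirDeriv (1, 0, 0) u q).im * (dirDeriv (0, 0, 1) u q).re) * φ (q.1, q.2.1)
    - lagrangianDensity μ ε k u q * dirDeriv (1, 0) φ (q.1, q.2.1)
    - ((dirDeriv (0, 1, 0) u q).re * ((dirDeriv (0, 1, 0) u q).re * dirDeriv (1, 0) φ (q.1, q.2.1)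
          - (dirDeriv (1, 0, 0) u q).re * dirDeriv (0, 1) φ (q.1, q.2.1))
      + (dirDeriv (0, 1, 0) u q).im * ((dirDeriv (0, 1, 0) u q).im * dirDeriv (1, 0) φ (q.1, q.2.1)
          - (dirDeriv (1, 0, 0) u q).im * dirDeriv (0, 1) φ (q.1, q.2.1)))

variable {u φ}

@[fun_prop]
lemma contDiff_lagrangianDensity (hu : ContDiff ℝ ∞ u) :
    ContDiff ℝ ∞ (lagrangianDensity μ ε k u) := by
  unfold lagrangianDensity
  fun_prop

lemma contDiff_vorticityFluxX (hu : ContDiff ℝ ∞ u) (hφ : ContDiff ℝ ∞ φ) :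
    ContDiff ℝ ∞ (vorticityFluxX μ ε k u φ) := by
  unfold vorticityFluxX
  fun_prop

lemma contDiff_vorticityFluxY (hu : ContDiff ℝ ∞ u) (hφ : ContDiff ℝ ∞ φ) :
    ContDiff ℝ ∞ (vorticityFluxY μ ε k u φ) := by
  unfold vorticityFluxY
  fun_prop

lemma vorticityFlux_periodic {c : ℝ × ℝ × ℝ} (hper : ∀ p, u (p + c) = u p)
    (hφper : ∀ p, φ (p + (c.1, c.2.1)) = φ p) (p : ℝ × ℝ × ℝ) :
    vorticityFluxX μ ε k u φ (p + c) = vorticityFluxX μ ε k u φ p ∧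
      vorticityFluxY μ ε k u φ (p + c) = vorticityFluxY μ ε k u φ p := by
  have h : ((p + c).1, (p + c).2.1) = (p.1, p.2.1) + (c.1, c.2.1) := rfl
  simp only [vorticityFluxX, vorticityFluxY, lagrangianDensity, h, dirDeriv_periodic hper, hper,
    dirDeriv_periodic hφper, hφper, and_self]

end Flux

lemma pointwise_vorticity_balance {μ ε k : ℝ} {u : ℝ × ℝ × ℝ → ℂ} (hu : ContDiff ℝ ∞ u)
    (hsol : ∀ p : ℝ × ℝ × ℝ,
      -Complex.I * pdt u p + ((μ * k : ℝ) : ℂ) * pdt (pdt u) p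
        - (pdx (pdx u) p + pdy (pdy u) p)
        + ((1 / ε ^ 2 : ℝ) : ℂ) * ((‖u p‖ ^ 2 - 1 : ℝ) : ℂ) * u p = 0)
    {φ : ℝ × ℝ → ℝ} (hφ : ContDiff ℝ ∞ φ) (p : ℝ × ℝ × ℝ) :
    -(μ * k) * pdt (fun q => ((starRingEnd ℂ) (pdy u q)
                  * (pdt u q * ((pdx2 φ (q.1, q.2.1) : ℝ) : ℂ))
                + (starRingEnd ℂ) (-pdx u q)
                  * (pdt u q * ((pdy2 φ (q.1, q.2.1) : ℝ) : ℂ))).re) p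
        - pdt (fun q => ((starRingEnd ℂ) (pdx u q) * pdy u q).im) p * φ (p.1, p.2.1)
        - ((starRingEnd ℂ) (((pdx2 (pdx2 φ) (p.1, p.2.1) : ℝ) : ℂ) * pdx u p
                + ((pdx2 (pdy2 φ) (p.1, p.2.1) : ℝ) : ℂ) * pdy u p)
              * pdy u p
            + (starRingEnd ℂ) (((pdy2 (pdx2 φ) (p.1, p.2.1) : ℝ) : ℂ) * pdx u p
                + ((pdy2 (pdy2 φ) (p.1, p.2.1) : ℝ) : ℂ) * pdy u p)
              * (-pdx u p)).re
      = dirDeriv (1, 0, 0) (vorticityFluxX μ ε k u φ) p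
        + dirDeriv (0, 1, 0) (vorticityFluxY μ ε k u φ) p := by
  have hre := congrArg Complex.re (hsol p)
  have him := congrArg Complex.im (hsol p)
  simp only [pdx_eq_dirDeriv, pdy_eq_dirDeriv, pdt_eq_dirDeriv, Complex.sq_norm,
    Complex.normSq_apply, Complex.add_re, Complex.add_im, Complex.sub_re, Complex.sub_im,
    Complex.mul_re, Complex.mul_im, Complex.neg_re, Complex.neg_im, Complex.ofReal_re,
    Complex.ofReal_im, Complex.I_re, Complex.I_im, Complex.zero_re, Complex.zero_im] at hre him
  have hzero (f : ℝ × ℝ → ℝ) (a : ℝ × ℝ) : dirDeriv (0, 0) f a = 0 := dirDeriv_zero f a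
  have hyx := dirDeriv_comm hu (0, 1, 0) (1, 0, 0) p
  have htx := dirDeriv_comm hu (0, 0, 1) (1, 0, 0) p
  have hty := dirDeriv_comm hu (0, 0, 1) (0, 1, 0) p
  have hφyx := dirDeriv_comm hφ (0, 1) (1, 0) (p.1, p.2.1)
  unfold vorticityFluxX vorticityFluxY lagrangianDensity
  simp (disch := fun_prop) only [pdx_eq_dirDeriv, pdy_eq_dirDeriv, pdt_eq_dirDeriv,
    pdx2_eq_dirDeriv, pdy2_eq_dirDeriv, map_add, map_mul, map_neg, Complex.conj_ofReal,
    Complex.add_re, Complex.add_im, Complex.mul_re, Complex.mul_im, Complex.neg_re,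
    Complex.neg_im, Complex.conj_re, Complex.conj_im, Complex.ofReal_re, Complex.ofReal_im,
    dirDeriv_add, dirDeriv_sub, dirDeriv_neg, dirDeriv_mul, dirDeriv_sq, dirDeriv_const,
    dirDeriv_re, dirDeriv_im, dirDeriv_comp_space, hzero, hyx, htx, hty, hφyx]
  linear_combination
    (-1) * ((dirDeriv (0, 1, 0) u p).re * dirDeriv (1, 0) φ (p.1, p.2.1)
        - (dirDeriv (1, 0, 0) u p).re * dirDeriv (0, 1) φ (p.1, p.2.1)) * hre
      - ((dirDeriv (0, 1, 0) u p).im * dirDeriv (1, 0) φ (p.1, p.2.1)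
        - (dirDeriv (1, 0, 0) u p).im * dirDeriv (0, 1) φ (p.1, p.2.1)) * him

/-- For a smooth spatially `ℤ²`-periodic solution `u` of the NLSW
`−i ∂_t u + μ k ∂_t² u − Δu + (1/ε²)(|u|² − 1)u = 0` and any smooth `ℤ²`-periodic
`φ : ℝ² → ℝ`, for every time `t`:
`−μk ∫ ∂_t ⟨𝕁∇u, (∂_t u)∇φ⟩ dx − ∫ (∂_t J(u)) φ dx = ∫ ⟨Hess(φ)∇u, 𝕁∇u⟩ dx`,
where `𝕁∇u = (∂_y u, −∂ₓ u)`, `J(u) = Im(∂ₓ ū ⬝ ∂_y u)`, and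
`⟨z, w⟩ = Re(z̄₁w₁ + z̄₂w₂)`. -/
theorem nlsw_weak_vorticity_identity (μ ε k : ℝ) (hμ : 0 < μ) (hε : 0 < ε) (hk : 0 < k)
    (u : ℝ × ℝ × ℝ → ℂ) (hu : ContDiff ℝ (⊤ : ℕ∞) u)
    (hper : ∀ (x y t : ℝ) (m n : ℤ), u (x + m, y + n, t) = u (x, y, t))
    (hsol : ∀ p : ℝ × ℝ × ℝ,
      -Complex.I * pdt u p + ((μ * k : ℝ) : ℂ) * pdt (pdt u) p
        - (pdx (pdx u) p + pdy (pdy u) p)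
        + ((1 / ε ^ 2 : ℝ) : ℂ) * ((‖u p‖ ^ 2 - 1 : ℝ) : ℂ) * u p = 0)
    (φ : ℝ × ℝ → ℝ) (hφ : ContDiff ℝ (⊤ : ℕ∞) φ)
    (hφper : ∀ (x y : ℝ) (m n : ℤ), φ (x + m, y + n) = φ (x, y)) :
    ∀ t : ℝ,
      -(μ * k) * (∫ x in Set.Icc (0 : ℝ) 1, ∫ y in Set.Icc (0 : ℝ) 1,
            pdt (fun q => ((starRingEnd ℂ) (pdy u q)
                  * (pdt u q * ((pdx2 φ (q.1, q.2.1) : ℝ) : ℂ))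
                + (starRingEnd ℂ) (-pdx u q)
                  * (pdt u q * ((pdy2 φ (q.1, q.2.1) : ℝ) : ℂ))).re) (x, y, t))
        - (∫ x in Set.Icc (0 : ℝ) 1, ∫ y in Set.Icc (0 : ℝ) 1,
            pdt (fun q => ((starRingEnd ℂ) (pdx u q) * pdy u q).im) (x, y, t) * φ (x, y))
      = ∫ x in Set.Icc (0 : ℝ) 1, ∫ y in Set.Icc (0 : ℝ) 1,
          ((starRingEnd ℂ) (((pdx2 (pdx2 φ) (x, y) : ℝ) : ℂ) * pdx u (x, y, t)
                + ((pdx2 (pdy2 φ) (x, y) : ℝ) : ℂ) * pdy u (x, y, t))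
              * pdy u (x, y, t)
            + (starRingEnd ℂ) (((pdy2 (pdx2 φ) (x, y) : ℝ) : ℂ) * pdx u (x, y, t)
                + ((pdy2 (pdy2 φ) (x, y) : ℝ) : ℂ) * pdy u (x, y, t))
              * (-pdx u (x, y, t))).re := by
  intro t
  have hemb : ContDiff ℝ ∞ fun p : ℝ × ℝ => (p.1, p.2, t) := by fun_prop
  have hslice {f : ℝ × ℝ × ℝ → ℝ} (hf : ContDiff ℝ ∞ f) :
      Continuous fun p : ℝ × ℝ => f (p.1, p.2, t) := (hf.comp hemb).continuous
  have hslice_deriv {f : ℝ × ℝ × ℝ → ℝ} (hf : ContDiff ℝ ∞ f) (v p : ℝ × ℝ) :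
      dirDeriv v (fun p : ℝ × ℝ => f (p.1, p.2, t)) p
        = dirDeriv (v.1, v.2, 0) f (p.1, p.2, t) := by
    have he : HasFDerivAt (fun p : ℝ × ℝ => (p.1, p.2, t))
        ((ContinuousLinearMap.fst ℝ ℝ ℝ).prod ((ContinuousLinearMap.snd ℝ ℝ ℝ).prod 0)) p :=
      hasFDerivAt_fst.prodMk (hasFDerivAt_snd.prodMk (hasFDerivAt_const t p))
    have h := (hf.differentiableAt_of_smooth (p.1, p.2, t)).hasFDerivAt.comp p he
    exact congrArg (fun T => T v) h.fderiv
  have hX := contDiff_vorticityFluxX μ ε k hu hφ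
  have hY := contDiff_vorticityFluxY μ ε k hu hφ
  have hflux (c : ℝ × ℝ) (hc : ∃ m n : ℤ, c = (↑m, ↑n)) (p : ℝ × ℝ) :=
    vorticityFlux_periodic (u := u) (φ := φ) μ ε k (c := (c.1, c.2, 0))
      (by obtain ⟨m, n, rfl⟩ := hc; intro q; simpa [Prod.add_def] using hper q.1 q.2.1 q.2.2 m n)
      (by obtain ⟨m, n, rfl⟩ := hc; intro q; simpa [Prod.add_def] using hφper q.1 q.2 m n) (p.1, p.2, t)
  have hdiv := integral_divergence_periodic (hX.comp hemb) (hY.comp hemb)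
    (fun p => by simpa using (hflux (1, 0) ⟨1, 0, by simp⟩ p).1)
    (fun p => by simpa using (hflux (0, 1) ⟨0, 1, by simp⟩ p).2)
  simp only [Function.comp_def, hslice_deriv hX, hslice_deriv hY,
    ← pointwise_vorticity_balance hu hsol hφ] at hdiv
  have hc₁ := hslice (f := pdt (fun q => ((starRingEnd ℂ) (pdy u q)
                  * (pdt u q * ((pdx2 φ (q.1, q.2.1) : ℝ) : ℂ))
                + (starRingEnd ℂ) (-pdx u q)
                  * (pdt u q * ((pdy2 φ (q.1, q.2.1) : ℝ) : ℂ))).re)) (by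
    simp only [pdx_eq_dirDeriv, pdy_eq_dirDeriv, pdt_eq_dirDeriv,
      pdx2_eq_dirDeriv, pdy2_eq_dirDeriv, map_neg, Complex.add_re, Complex.mul_re, Complex.mul_im,
      Complex.neg_re, Complex.neg_im, Complex.conj_re, Complex.conj_im, Complex.ofReal_re,
      Complex.ofReal_im]
    fun_prop)
  have hc₂ := hslice
    (f := fun p => pdt (fun q => ((starRingEnd ℂ) (pdx u q) * pdy u q).im) p * φ (p.1, p.2.1)) (by
    simp only [pdx_eq_dirDeriv, pdy_eq_dirDeriv, pdt_eq_dirDeriv, Complex.mul_im,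
      Complex.conj_re, Complex.conj_im]
    fun_prop)
  have hc₃ := hslice (f := fun p =>
        ((starRingEnd ℂ) (((pdx2 (pdx2 φ) (p.1, p.2.1) : ℝ) : ℂ) * pdx u p
                + ((pdx2 (pdy2 φ) (p.1, p.2.1) : ℝ) : ℂ) * pdy u p)
              * pdy u p
            + (starRingEnd ℂ) (((pdy2 (pdx2 φ) (p.1, p.2.1) : ℝ) : ℂ) * pdx u p
                + ((pdy2 (pdy2 φ) (p.1, p.2.1) : ℝ) : ℂ) * pdy u p)
              * (-pdx u p)).re) (by
    simp only [pdx_eq_dirDeriv, pdy_eq_dirDeriv, pdx2_eq_dirDeriv, pdy2_eq_dirDeriv, map_add,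
      map_mul, Complex.conj_ofReal, Complex.add_re, Complex.add_im, Complex.mul_re, Complex.mul_im,
      Complex.neg_re, Complex.neg_im, Complex.conj_re, Complex.conj_im, Complex.ofReal_re,
      Complex.ofReal_im]
    fun_prop)
  have hi₁ := (hc₁.const_mul (-(μ * k))).integrableOn_unitSquare
  have hi₂ := hc₂.integrableOn_unitSquare
  have hi₃ := hc₃.integrableOn_unitSquare
  have h := integral_sub (hi₁.sub hi₂) hi₃
  rw [integral_sub' hi₁ hi₂, integral_const_mul, ← hc₁.integral_unitSquare,
    ← hc₂.integral_unitSquare, ← hc₃.integral_unitSquare] at h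
  exact sub_eq_zero.mp (h.symm.trans hdiv)
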